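/- Let R^10 be the profile ≽_1: {a,c},{b,d}; ≽_2: b,{a,c},d; ≽_3: a,d,{b,c}; ≽_4: {b,c},a,d. Then f(R^10)(d) = 0 and f(R^10)(b) = 1/2. -/

import Mathlib

open Finset
open scoped Classical

section Framework

variable {A : Type*} [Fintype A] {n : ℕ}

/-- `p` is a lottery (probability distribution) on the set of alternatives `A`. -/
def IsLottery (p : A → ℝ) : Prop := (∀ x, 0 ≤ p x) ∧ ∑ x, p x = 1

/-- `r` is a weak preference relation: complete (total) and transitive. -/
def IsPref (r : A → A → Prop) : Prop := Total r ∧ Transitive r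

/-- A preference profile assigns a weak preference relation to each of the `n` agents. -/
def IsProfile (R : Fin n → A → A → Prop) : Prop := ∀ i, IsPref (R i)

/-- The probability that `p` assigns to alternatives weakly preferred (by `r`) to `x`. -/
noncomputable def upperProb (r : A → A → Prop) (p : A → ℝ) (x : A) : ℝ :=
  ∑ y ∈ univ.filter (fun y => r y x), p y

/-- Stochastic dominance: `p ≽^sd q` w.r.t. the preference relation `r`. -/
def SDge (r : A → A → Prop) (p q : A → ℝ) : Prop :=
  ∀ x, upperProb r q x ≤ upperProb r p x

/-- Strict stochastic dominance: `p ≻^sd q` w.r.t. the preference relation `r`. -/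
def SDgt (r : A → A → Prop) (p q : A → ℝ) : Prop :=
  SDge r p q ∧ ¬ SDge r q p

/-- A social decision scheme maps every preference profile to a lottery. -/
def IsSDS (f : (Fin n → A → A → Prop) → (A → ℝ)) : Prop :=
  ∀ R : Fin n → A → A → Prop, IsProfile R → IsLottery (f R)

/-- Anonymity: invariance under permutations of the agents. -/
def Anonymous (f : (Fin n → A → A → Prop) → (A → ℝ)) : Prop :=
  ∀ R : Fin n → A → A → Prop, IsProfile R → ∀ π : Equiv.Perm (Fin n),
    f (fun i => R (π i)) = f R

/-- Neutrality: `f(R^σ)(σ x) = f(R)(x)`, where `R^σ` relabels alternatives by `σ`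
(i.e. `σ x ≽^σ_i σ y ↔ x ≽_i y`). -/
def Neutral (f : (Fin n → A → A → Prop) → (A → ℝ)) : Prop :=
  ∀ R : Fin n → A → A → Prop, IsProfile R → ∀ σ : Equiv.Perm A, ∀ x : A,
    f (fun i u v => R i (σ.symm u) (σ.symm v)) (σ x) = f R x

/-- The lottery `p` is sd-efficient for the profile `R`: no lottery `q` is weakly
sd-preferred to `p` by all agents and strictly sd-preferred by some agent. -/
def SDEfficientLottery (R : Fin n → A → A → Prop) (p : A → ℝ) : Prop :=
  ¬ ∃ q : A → ℝ, IsLottery q ∧ (∀ i, SDge (R i) q p) ∧ (∃ i, SDgt (R i) q p)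

/-- sd-efficiency of a social decision scheme. -/
def SDEfficient (f : (Fin n → A → A → Prop) → (A → ℝ)) : Prop :=
  ∀ R : Fin n → A → A → Prop, IsProfile R → SDEfficientLottery R (f R)

/-- sd-strategyproofness: no agent can misreport and obtain a strictly
sd-preferred lottery. -/
def SDStrategyproof (f : (Fin n → A → A → Prop) → (A → ℝ)) : Prop :=
  ∀ R R' : Fin n → A → A → Prop, IsProfile R → IsProfile R' → ∀ i : Fin n,
    (∀ j, j ≠ i → R j = R' j) → ¬ SDgt (R i) (f R') (f R)

/-- `x` is the unique most-preferred alternative of the relation `r`. -/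
def UniqueTop (r : A → A → Prop) (x : A) : Prop :=
  ∀ y, y ≠ x → r x y ∧ ¬ r y x

/-- `f` extends random dictatorship: whenever every agent has a unique top choice,
each alternative gets probability (number of agents having it as top)/n. -/
def ExtendsRD (f : (Fin n → A → A → Prop) → (A → ℝ)) : Prop :=
  ∀ R : Fin n → A → A → Prop, IsProfile R →
    ∀ t : Fin n → A, (∀ i, UniqueTop (R i) (t i)) →
      ∀ x : A, f R x = ((univ.filter (fun i => t i = x)).card : ℝ) / (n : ℝ)

/-- `x` is Pareto-dominated in the profile `R`. -/
def Pareto_Dominated (R : Fin n → A → A → Prop) (x : A) : Prop :=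
  ∃ y : A, (∀ i, R i y x) ∧ ∃ i, R i y x ∧ ¬ R i x y

end Framework

/-! Concrete setting: alternatives `A = {a,b,c,d}` encoded as `Fin 4`. -/

/-- The alternative `a`. -/ def a : Fin 4 := 0
/-- The alternative `b`. -/ def b : Fin 4 := 1
/-- The alternative `c`. -/ def c : Fin 4 := 2
/-- The alternative `d`. -/ def d : Fin 4 := 3

/-- The weak preference relation induced by a rank function over `(a,b,c,d)`
(lower rank = more preferred; equal ranks = indifference). -/
def pr (rk : Fin 4 → ℕ) : Fin 4 → Fin 4 → Prop := fun x y => rk x ≤ rk y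


/-- The profile `R10`: ≽₁: {a,c},{b,d}; ≽₂: b,{a,c},d; ≽₃: a,d,{b,c}; ≽₄: {b,c},a,d. -/
def R10 : Fin 4 → Fin 4 → Fin 4 → Prop :=
  ![pr ![0,1,0,1], pr ![1,0,1,2], pr ![0,2,2,1], pr ![1,0,0,2]]

/-- The profile in which agent `i` ranks the alternatives by `K i` (lower is better). -/
def rankProfile (K : Fin 4 → Fin 4 → ℕ) : Fin 4 → Fin 4 → Fin 4 → Prop := fun i => pr (K i)

theorem isProfile_rankProfile (K : Fin 4 → Fin 4 → ℕ) : IsProfile (rankProfile K) := by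
  intro i
  exact ⟨fun x y => Nat.le_total (K i x) (K i y), fun _ _ _ => Nat.le_trans⟩

theorem upperProb_pr (rk : Fin 4 → ℕ) (p : Fin 4 → ℝ) (x : Fin 4) :
    upperProb (pr rk) p x = ∑ y, if rk y ≤ rk x then p y else 0 := by
  rw [upperProb, Finset.sum_filter]
  exact Finset.sum_congr rfl fun y _ => if_congr Iff.rfl rfl rfl

section Axioms

variable {f : (Fin 4 → Fin 4 → Fin 4 → Prop) → (Fin 4 → ℝ)}

/-- Alternatives exchanged by an automorphism of the profile get the same probability. -/
theorem apply_eq_of_automorphism (han : Anonymous f) (hneu : Neutral f)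
    (K : Fin 4 → Fin 4 → ℕ) (π σ : Equiv.Perm (Fin 4))
    (h : ∀ i u, K (π i) u = K i (σ u)) (x : Fin 4) :
    f (rankProfile K) (σ x) = f (rankProfile K) x := by
  have hP := isProfile_rankProfile K
  have hσ : (fun i u v => rankProfile K (π i) (σ.symm u) (σ.symm v)) = rankProfile K := by
    funext i u v
    simp [rankProfile, pr, h]
  have key := hneu (fun i => rankProfile K (π i)) (fun i => hP (π i)) σ x
  rwa [hσ, han _ hP π] at key

/-- A misreport which is weakly beneficial is not strictly beneficial. -/
theorem sdge_of_misreport_sdge (hsp : SDStrategyproof f) (K K' : Fin 4 → Fin 4 → ℕ) (i : Fin 4)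
    (hK : ∀ j, j ≠ i → K j = K' j)
    (h : SDge (pr (K i)) (f (rankProfile K')) (f (rankProfile K))) :
    SDge (pr (K i)) (f (rankProfile K)) (f (rankProfile K')) := by
  by_contra hlt
  exact hsp _ _ (isProfile_rankProfile K) (isProfile_rankProfile K') i
    (fun j hj => congrArg pr (hK j hj)) ⟨h, hlt⟩

/-- A lottery which every agent weakly prefers to the outcome is strictly preferred by none. -/
theorem sdge_of_forall_sdge (heff : SDEfficient f) (K : Fin 4 → Fin 4 → ℕ) {q : Fin 4 → ℝ}
    (hq : IsLottery q) (h : ∀ i, SDge (pr (K i)) q (f (rankProfile K))) (i : Fin 4) :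
    SDge (pr (K i)) (f (rankProfile K)) q := by
  by_contra hlt
  exact heff _ (isProfile_rankProfile K) ⟨q, hq, h, i, h i, hlt⟩

/-- On four agents and four alternatives, no anonymous and neutral social decision scheme is both
sd-efficient and sd-strategyproof. -/
theorem not_sdEfficient_and_sdStrategyproof (hf : IsSDS f) (han : Anonymous f) (hneu : Neutral f)
    (heff : SDEfficient f) (hsp : SDStrategyproof f) : False := by
  have lottery (K : Fin 4 → Fin 4 → ℕ) := hf _ (isProfile_rankProfile K)
  have nonneg (K : Fin 4 → Fin 4 → ℕ) := (lottery K).1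
  have total (K : Fin 4 → Fin 4 → ℕ) := (lottery K).2
  simp only [Fin.sum_univ_four] at total
  -- `{a,b},{c,d}; {a,d},c,b; {b,c},a,d; {c,d},{a,b}`
  let S : Fin 4 → Fin 4 → ℕ := ![![0,0,1,1], ![0,2,1,0], ![1,0,0,2], ![1,1,0,0]]
  -- `{a,b},{c,d}; {a,d},c,b; {a,c},d,b; {c,d},{a,b}`
  let T : Fin 4 → Fin 4 → ℕ := ![![0,0,1,1], ![0,2,1,0], ![0,2,0,1], ![1,1,0,0]]
  -- `{a,b},{c,d}; {a,b},c,d; {a,c},d,b; {c,d},{a,b}`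
  let U : Fin 4 → Fin 4 → ℕ := ![![0,0,1,1], ![0,0,1,2], ![0,2,0,1], ![1,1,0,0]]
  -- `{a,b},{c,d}; {a,b},c,d; {a,c},d,b; {c,d},b,a`
  let V : Fin 4 → Fin 4 → ℕ := ![![0,0,1,1], ![0,0,1,2], ![0,2,0,1], ![2,1,0,0]]
  -- `{a,b},{c,d}; {a,b},c,d; {a,c},d,b; {b,c},d,a`
  let W : Fin 4 → Fin 4 → ℕ := ![![0,0,1,1], ![0,0,1,2], ![0,2,0,1], ![2,0,0,1]]
  -- `{b,d},a,c; {a,b},c,d; {a,c},d,b; {c,d},b,a`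
  let X : Fin 4 → Fin 4 → ℕ := ![![1,0,2,0], ![0,0,1,2], ![0,2,0,1], ![2,1,0,0]]
  have hS : f (rankProfile S) 0 + f (rankProfile S) 2 = 1 := by
    have sym := apply_eq_of_automorphism han hneu S
      (Equiv.swap 0 3 * Equiv.swap 1 2) (Equiv.swap 0 2 * Equiv.swap 1 3) (by decide)
    have h0 : f (rankProfile S) 2 = f (rankProfile S) 0 := sym 0
    have h1 : f (rankProfile S) 3 = f (rankProfile S) 1 := sym 1
    have hq : IsLottery (![1/2, 0, 1/2, 0] : Fin 4 → ℝ) := by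
      constructor
      · intro x; fin_cases x <;> simp
      · simp [Fin.sum_univ_four]; norm_num
    have hn := nonneg S 1
    have ht := total S
    have key := sdge_of_forall_sdge heff S hq (by
      intro i x
      rw [upperProb_pr, upperProb_pr]
      fin_cases i <;> fin_cases x <;> simp [S, Fin.sum_univ_four] <;> linarith) 1 2
    rw [upperProb_pr, upperProb_pr] at key
    simp [S, Fin.sum_univ_four] at key
    linarith [nonneg S 3]
  have hT : f (rankProfile T) 0 = 1 := by
    have sym : f (rankProfile T) 3 = f (rankProfile T) 2 := apply_eq_of_automorphism han hneu T
      (Equiv.swap 1 2) (Equiv.swap 2 3) (by decide) 2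
    have hn := nonneg T
    have ht := total T
    have hm := nonneg S
    have hs := total S
    have key := sdge_of_misreport_sdge hsp T S 2 (by decide) (by
      intro x
      rw [upperProb_pr, upperProb_pr]
      fin_cases x <;> simp [T, Fin.sum_univ_four] <;>
        linarith [hn 0, hn 1, hn 2, hn 3, hm 0, hm 1, hm 2, hm 3]) 0
    rw [upperProb_pr, upperProb_pr] at key
    simp [T, Fin.sum_univ_four] at key
    linarith [hn 1, hn 3]
  have hU : f (rankProfile U) 0 + f (rankProfile U) 1 = 1 := by
    have hn := nonneg U
    have ht := total U
    have hm := nonneg T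
    have hs := total T
    have key := sdge_of_misreport_sdge hsp U T 1 (by decide) (by
      intro x
      rw [upperProb_pr, upperProb_pr]
      fin_cases x <;> simp [U, Fin.sum_univ_four] <;>
        linarith [hn 0, hn 1, hn 2, hn 3, hm 0, hm 1, hm 2, hm 3]) 0
    rw [upperProb_pr, upperProb_pr] at key
    simp [U, Fin.sum_univ_four] at key
    linarith [hn 2, hn 3, hm 1]
  have hV : f (rankProfile V) 0 + f (rankProfile V) 1 = 1 := by
    have hn := nonneg U
    have ht := total U
    have hm := nonneg V
    have hs := total V
    have key := sdge_of_misreport_sdge hsp U V 3 (by decide) (by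
      intro x
      rw [upperProb_pr, upperProb_pr]
      fin_cases x <;> simp [U, Fin.sum_univ_four] <;>
        linarith [hn 0, hn 1, hn 2, hn 3, hm 0, hm 1, hm 2, hm 3]) 2
    rw [upperProb_pr, upperProb_pr] at key
    simp [U, Fin.sum_univ_four] at key
    linarith [hm 2, hm 3]
  have hn := nonneg V
  have ht := total V
  have hVb : 1/2 ≤ f (rankProfile V) 1 := by
    by_contra! hlt
    have sym : f (rankProfile W) 1 = f (rankProfile W) 0 := apply_eq_of_automorphism han hneu W
      (Equiv.swap 2 3) (Equiv.swap 0 1) (by decide) 0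
    have hm := nonneg W
    have hs := total W
    have key := sdge_of_misreport_sdge hsp V W 3 (by decide) (by
      intro x
      rw [upperProb_pr, upperProb_pr]
      fin_cases x <;> simp [V, Fin.sum_univ_four] <;>
        linarith [hn 0, hn 1, hn 2, hn 3, hm 0, hm 1, hm 2, hm 3]) 1
    rw [upperProb_pr, upperProb_pr] at key
    simp [V, Fin.sum_univ_four] at key
    linarith [hn 2, hn 3, hm 2, hm 3]
  have sym := apply_eq_of_automorphism han hneu X (finRotate 4).symm ⟨![2, 0, 3, 1],
    ![1, 3, 0, 2], by decide, by decide⟩ (by decide)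
  have h0 : f (rankProfile X) 2 = f (rankProfile X) 0 := sym 0
  have h1 : f (rankProfile X) 0 = f (rankProfile X) 1 := sym 1
  have h2 : f (rankProfile X) 3 = f (rankProfile X) 2 := sym 2
  have hs := total X
  have key := sdge_of_misreport_sdge hsp X V 0 (by decide) (by
    intro x
    rw [upperProb_pr, upperProb_pr]
    fin_cases x <;> simp [X, Fin.sum_univ_four] <;>
      linarith [hn 0, hn 1, hn 2, hn 3]) 0
  rw [upperProb_pr, upperProb_pr] at key
  simp [X, Fin.sum_univ_four] at key
  linarith [hn 2, hn 3]

end Axioms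

theorem stmt13 (f : (Fin 4 → Fin 4 → Fin 4 → Prop) → (Fin 4 → ℝ))
    (hf : IsSDS f) (han : Anonymous f) (hneu : Neutral f)
    (heff : SDEfficient f) (hsp : SDStrategyproof f) :
    f R10 d = 0 ∧ f R10 b = 1/2 := by
  exact (not_sdEfficient_and_sdStrategyproof hf han hneu heff hsp).elim
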